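/- arXiv:1107.2493 — 2 statements merged into one kernel-verified Lean document; each statement's English description precedes it below -/
import Mathlib

section
/- Let (n_i)_{i∈ℕ} be a sequence of integers with n_i ≥ 2, set m_k = n_1·n_2···n_k, and let X = lim← ℤ/m_kℤ be the inverse limit (the subspace of ∏_k ℤ/m_kℤ of compatible sequences, with the product topology), on which ℤ acts freely by translation n·x = x + n (the odometer system associated with (n_i)). For each prime p put ε_p = sup{m : p^m divides m_k for some k} ∈ ℤ≥0 ∪ {∞}. Then this odometer is a uniquely ergodic Cantor minimal ℤ-system and its fundamental group F(R_{ℤ,φ}) equals the multiplicative subgroup of ℝ_{>0} generated by the primes p with ε_p = ∞, i.e., {p₁^{m₁}···p_n^{m_n} : n ∈ ℕ, ε_{p_i} = ∞, m_i ∈ ℤ}. -/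
open MeasureTheory
open scoped ENNReal

/-- The group of self-homeomorphisms of a space, under composition. -/
instance homeomorphGroup {X : Type*} [TopologicalSpace X] : Group (X ≃ₜ X) where
  mul f g := g.trans f
  one := Homeomorph.refl X
  inv := Homeomorph.symm
  mul_assoc f g h := rfl
  one_mul f := Homeomorph.ext fun x => rfl
  mul_one f := Homeomorph.ext fun x => rfl
  inv_mul_cancel f := Homeomorph.ext fun x => f.symm_apply_apply x

section Defs

variable {X Y : Type*} [TopologicalSpace X] [TopologicalSpace Y]

/-- The orbit equivalence relation `R_{G,φ}` of an action of `G` on `X` by homeomorphisms. -/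
def orbitRelOf {G : Type*} [Group G] (φ : G →* (X ≃ₜ X)) : Set (X × X) :=
  {p | ∃ g : G, φ g p.1 = p.2}

/-- Freeness of an action by homeomorphisms. -/
def IsFreeAction {G : Type*} [Group G] (φ : G →* (X ≃ₜ X)) : Prop :=
  ∀ g : G, g ≠ 1 → ∀ x : X, φ g x ≠ x

/-- The orbit relation of a single homeomorphism, i.e. of the generated `ℤ`-action. -/
def orbitRelZ (φ : X ≃ₜ X) : Set (X × X) :=
  {p | ∃ n : ℤ, (φ ^ n) p.1 = p.2}

/-- Freeness of the `ℤ`-action generated by a homeomorphism. -/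
def IsFreeZ (φ : X ≃ₜ X) : Prop :=
  ∀ n : ℤ, n ≠ 0 → ∀ x : X, (φ ^ n) x ≠ x

/-- Minimality of an orbit equivalence relation: every class `R[x]` is dense. -/
def IsMinimalRel (R : Set (X × X)) : Prop :=
  ∀ x : X, Dense {y : X | (x, y) ∈ R}

/-- A Borel measure is `R`-invariant if it is invariant under every homeomorphism `h`
with `(x, h x) ∈ R` for all `x`. -/
def IsInvariantMeasure [MeasurableSpace X] (R : Set (X × X)) (μ : Measure X) : Prop :=
  ∀ h : X ≃ₜ X, (∀ x : X, (x, h x) ∈ R) → Measure.map h μ = μ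

/-- Restriction `R|_U = R ∩ (U × U)` of a relation, as a relation on the subtype `U`. -/
def restrictRel (R : Set (X × X)) (U : Set X) : Set (↥U × ↥U) :=
  {p | ((p.1 : X), (p.2 : X)) ∈ R}

/-- `R^n` on `X × {1,…,n}`: `((x,i),(y,j)) ∈ R^n ↔ (x,y) ∈ R`. -/
def finProdRel (R : Set (X × X)) (n : ℕ) : Set ((X × Fin n) × (X × Fin n)) :=
  {p | (p.1.1, p.2.1) ∈ R}

/-- `R^∞` on `X × ℕ`: `((x,i),(y,j)) ∈ R^∞ ↔ (x,y) ∈ R`. -/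
def natProdRel (R : Set (X × X)) : Set ((X × ℕ) × (X × ℕ)) :=
  {p | (p.1.1, p.2.1) ∈ R}

/-- Topological orbit equivalence of two equivalence relations: a homeomorphism `F` of the
underlying spaces with `(F × F)(R₁) = R₂`. -/
def OrbitEquiv (R₁ : Set (X × X)) (R₂ : Set (Y × Y)) : Prop :=
  ∃ F : X ≃ₜ Y, ∀ x y : X, (x, y) ∈ R₁ ↔ (F x, F y) ∈ R₂

/-- The fundamental group `F(R)` of a uniquely ergodic Cantor minimal system, where `μ` is
the unique invariant probability measure: the set of values `(μ × δ)(U)` (with `δ` counting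
measure) over clopen sets `U ⊆ X × {1,…,n}`, `n ∈ ℕ`, such that `R^n|_U` is orbit
equivalent to `R`. -/
noncomputable def fundGroup [MeasurableSpace X] (R : Set (X × X)) (μ : Measure X) : Set ℝ :=
  {l : ℝ | ∃ (n : ℕ) (U : Set (X × Fin n)), IsClopen U ∧
    OrbitEquiv R (restrictRel (finProdRel R n) U) ∧
    l = ((μ.prod Measure.count) U).toReal}

/-- `E_μ`: the additive subgroup of `ℝ` generated by the measures of clopen sets. -/
noncomputable def clopenValueGroup [MeasurableSpace X] (μ : Measure X) : AddSubgroup ℝ :=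
  AddSubgroup.closure {r : ℝ | ∃ V : Set X, IsClopen V ∧ r = (μ V).toReal}

/-- The positive inner multiplier group `IM₊(E)` of an additive subgroup of `ℝ`. -/
def IMplus (E : AddSubgroup ℝ) : Set ℝ :=
  {t : ℝ | 0 < t ∧ t ∈ E ∧ t⁻¹ ∈ E ∧ (fun x => t * x) '' (E : Set ℝ) = (E : Set ℝ)}

end Defs

/-- The partial products `m_k = n_1 ⋯ n_k` of the defining sequence of an odometer. -/
def mSeq (nseq : ℕ → ℕ) (k : ℕ) : ℕ := ∏ i ∈ Finset.range (k + 1), nseq i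

lemma mSeq_dvd (nseq : ℕ → ℕ) (k : ℕ) : mSeq nseq k ∣ mSeq nseq (k + 1) :=
  ⟨nseq (k + 1), Finset.prod_range_succ nseq (k + 1)⟩

/-- The odometer space: the inverse limit `lim← ℤ/m_kℤ`. -/
def OdoSpace (nseq : ℕ → ℕ) : Type :=
  {x : ∀ k, ZMod (mSeq nseq k) //
    ∀ k, ZMod.castHom (mSeq_dvd nseq k) (ZMod (mSeq nseq k)) (x (k + 1)) = x k}

/-- The odometer space carries the (profinite) topology inherited from the product of the
discrete topologies. -/
instance (nseq : ℕ → ℕ) : TopologicalSpace (OdoSpace nseq) :=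
  TopologicalSpace.induced Subtype.val
    (@Pi.topologicalSpace ℕ (fun k => ZMod (mSeq nseq k)) (fun _ => ⊥))

instance (nseq : ℕ → ℕ) : MeasurableSpace (OdoSpace nseq) := borel _

instance (nseq : ℕ → ℕ) : BorelSpace (OdoSpace nseq) := ⟨rfl⟩

/-- The odometer map: translation by `1` (addition of `(1,0,0,…)` with carry). -/
def odometer (nseq : ℕ → ℕ) : OdoSpace nseq ≃ₜ OdoSpace nseq where
  toFun x := ⟨fun k => x.1 k + 1, fun k => by rw [map_add, x.2 k, map_one]⟩
  invFun x := ⟨fun k => x.1 k - 1, fun k => by rw [map_sub, x.2 k, map_one]⟩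
  left_inv x := Subtype.ext (funext fun k => add_sub_cancel_right _ _)
  right_inv x := Subtype.ext (funext fun k => sub_add_cancel _ _)
  continuous_toFun := by
    letI : ∀ k, TopologicalSpace (ZMod (mSeq nseq k)) := fun _ => ⊥
    haveI : ∀ k, DiscreteTopology (ZMod (mSeq nseq k)) := fun _ => ⟨rfl⟩
    apply continuous_induced_rng.2
    apply continuous_pi
    intro k
    have h1 : Continuous fun x : OdoSpace nseq => x.1 k :=
      (continuous_apply k).comp continuous_induced_dom
    have h2 : Continuous fun z : ZMod (mSeq nseq k) => z + 1 :=
      continuous_of_discreteTopology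
    exact h2.comp h1
  continuous_invFun := by
    letI : ∀ k, TopologicalSpace (ZMod (mSeq nseq k)) := fun _ => ⊥
    haveI : ∀ k, DiscreteTopology (ZMod (mSeq nseq k)) := fun _ => ⟨rfl⟩
    apply continuous_induced_rng.2
    apply continuous_pi
    intro k
    have h1 : Continuous fun x : OdoSpace nseq => x.1 k :=
      (continuous_apply k).comp continuous_induced_dom
    have h2 : Continuous fun z : ZMod (mSeq nseq k) => z - 1 :=
      continuous_of_discreteTopology
    exact h2.comp h1


/-- Two closed embeddings that differ pointwise by translations from a countable set transport
an invariant measure to the same measure. -/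
lemma measure_image_eq_of_forall_add {Y Z ι : Type*} [AddCommGroup Y] [TopologicalSpace Y]
    [ContinuousAdd Y] [T2Space Y] [MeasurableSpace Y] [BorelSpace Y] (μ : Measure Y)
    [μ.IsAddLeftInvariant] [Countable ι] {v : ι → Y} (hv : Function.Injective v)
    [TopologicalSpace Z] [MeasurableSpace Z] [BorelSpace Z] {e₁ e₂ : Z → Y}
    (h₁ : Topology.IsClosedEmbedding e₁) (h₂ : Topology.IsClosedEmbedding e₂)
    (h : ∀ z, ∃ i, v i + e₁ z = e₂ z) {A : Set Z} (hA : MeasurableSet A) :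
    μ (e₁ '' A) = μ (e₂ '' A) := by
  have hm₁ := h₁.measurableEmbedding
  have hm₂ := h₂.measurableEmbedding
  set B : ι → Set Z := fun i => A ∩ {z | v i + e₁ z = e₂ z} with hB
  have hBm : ∀ i, MeasurableSet (B i) := fun i => hA.inter
    (isClosed_eq (continuous_const.add h₁.continuous) h₂.continuous).measurableSet
  have hAB : A = ⋃ i, B i := by
    ext z
    obtain ⟨i, hi⟩ := h z
    simp only [hB, Set.mem_iUnion, Set.mem_inter_iff]
    exact ⟨fun hz => ⟨i, hz, hi⟩, fun ⟨_, hz, _⟩ => hz⟩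
  have hd : Pairwise (Function.onFun Disjoint B) := fun i j hij =>
    Set.disjoint_left.2 fun z hi hj => hij (hv (add_right_cancel (hi.2.trans hj.2.symm)))
  rw [hAB, Set.image_iUnion, Set.image_iUnion,
    measure_iUnion (fun i j hij => (Set.disjoint_image_iff hm₁.injective).2 (hd hij))
      fun i => hm₁.measurableSet_image' (hBm i),
    measure_iUnion (fun i j hij => (Set.disjoint_image_iff hm₂.injective).2 (hd hij))
      fun i => hm₂.measurableSet_image' (hBm i)]
  refine tsum_congr fun i => ?_
  have : e₂ '' B i = (fun y => -v i + y) ⁻¹' (e₁ '' B i) := by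
    rw [show (fun y => -v i + y) = (Equiv.addLeft (v i)).symm from rfl,
      ← Equiv.image_eq_preimage_symm, Set.image_image]
    exact Set.image_congr fun z hz => hz.2.symm
  rw [this, measure_preimage_add]

namespace OdoSpace

instance {nseq : ℕ → ℕ} [h : Fact (∀ i, 2 ≤ nseq i)] (k : ℕ) : NeZero (mSeq nseq k) :=
  ⟨Finset.prod_ne_zero_iff.2 fun i _ => by have := h.out i; omega⟩

/-- The inverse limit as a subring of the product of its levels. -/
def subring (nseq : ℕ → ℕ) : Subring (∀ k, ZMod (mSeq nseq k)) where
  carrier := {x | ∀ k, ZMod.castHom (mSeq_dvd nseq k) (ZMod (mSeq nseq k)) (x (k + 1)) = x k}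
  mul_mem' hx hy k := by rw [Pi.mul_apply, map_mul, hx k, hy k, Pi.mul_apply]
  one_mem' k := by rw [Pi.one_apply, map_one, Pi.one_apply]
  add_mem' hx hy k := by rw [Pi.add_apply, map_add, hx k, hy k, Pi.add_apply]
  zero_mem' k := by rw [Pi.zero_apply, map_zero, Pi.zero_apply]
  neg_mem' hx k := by rw [Pi.neg_apply, map_neg, hx k, Pi.neg_apply]

instance (nseq : ℕ → ℕ) : CommRing (OdoSpace nseq) := inferInstanceAs (CommRing (subring nseq))

instance (nseq : ℕ → ℕ) : IsTopologicalRing (OdoSpace nseq) :=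
  inferInstanceAs (IsTopologicalRing (subring nseq))

instance (nseq : ℕ → ℕ) : TotallyDisconnectedSpace (OdoSpace nseq) :=
  inferInstanceAs (TotallyDisconnectedSpace (subring nseq))

instance (nseq : ℕ → ℕ) : TopologicalSpace.MetrizableSpace (OdoSpace nseq) :=
  have (n : ℕ) : TopologicalSpace.MetrizableSpace (ZMod n) := inferInstance
  have h : Topology.IsEmbedding (Subtype.val : subring nseq → ∀ k, ZMod (mSeq nseq k)) := .subtypeVal
  h.metrizableSpace

instance (nseq : ℕ → ℕ) : SecondCountableTopology (OdoSpace nseq) :=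
  have (n : ℕ) : Countable (ZMod n) := ZMod.intCast_surjective.countable
  have h : Topology.IsEmbedding (Subtype.val : subring nseq → ∀ k, ZMod (mSeq nseq k)) := .subtypeVal
  h.secondCountableTopology

/-- The projection of the inverse limit to its `k`-th level. -/
def proj {nseq : ℕ → ℕ} (k : ℕ) : OdoSpace nseq →+* ZMod (mSeq nseq k) :=
  (Pi.evalRingHom (fun k => ZMod (mSeq nseq k)) k).comp (subring nseq).subtype

variable {nseq : ℕ → ℕ}

lemma continuous_proj (k : ℕ) : Continuous (proj k : OdoSpace nseq → ZMod (mSeq nseq k)) :=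
  (continuous_apply k).comp continuous_induced_dom

@[ext]
lemma ext_proj {x y : OdoSpace nseq} (h : ∀ k, proj k x = proj k y) : x = y :=
  Subtype.ext (funext h)

lemma proj_succ (x : OdoSpace nseq) (k : ℕ) :
    ZMod.castHom (mSeq_dvd nseq k) (ZMod (mSeq nseq k)) (proj (k + 1) x) = proj k x :=
  x.2 k

lemma mSeq_dvd_of_le {k l : ℕ} (h : k ≤ l) : mSeq nseq k ∣ mSeq nseq l := by
  induction h with
  | refl => exact dvd_rfl
  | step _ ih => exact ih.trans (mSeq_dvd nseq _)

lemma castHom_proj {k l : ℕ} (h : k ≤ l) (x : OdoSpace nseq) :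
    ZMod.castHom (mSeq_dvd_of_le h) (ZMod (mSeq nseq k)) (proj l x) = proj k x := by
  induction h with
  | refl => simp
  | @step l h ih =>
    rw [← ih, ← proj_succ x l]
    exact RingHom.congr_fun (RingHom.ext_zmod _
      ((ZMod.castHom (mSeq_dvd_of_le h) _).comp (ZMod.castHom (mSeq_dvd nseq l) _))) _

lemma proj_eq_of_le {k l : ℕ} (h : k ≤ l) {x y : OdoSpace nseq} (hxy : proj l x = proj l y) :
    proj k x = proj k y := by
  rw [← castHom_proj h, ← castHom_proj h, hxy]

lemma odometer_zpow_apply (n : ℤ) (x : OdoSpace nseq) :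
    (odometer nseq ^ n) x = x + n := by
  have h1 : ∀ y, odometer nseq y = y + 1 := fun y => rfl
  have h2 : ∀ y, (odometer nseq)⁻¹ y = y - 1 := fun y => rfl
  induction n using Int.induction_on generalizing x with
  | zero => simp
  | succ n ih =>
    rw [zpow_add_one]
    change (odometer nseq ^ (n : ℤ)) (odometer nseq x) = _
    rw [ih, h1]; push_cast; ring
  | pred n ih =>
    rw [zpow_sub_one]
    change (odometer nseq ^ (-n : ℤ)) ((odometer nseq)⁻¹ x) = _
    rw [ih, h2]; push_cast; ring

lemma mem_orbitRelZ {x y : OdoSpace nseq} :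
    (x, y) ∈ orbitRelZ (odometer nseq) ↔ ∃ n : ℤ, x + n = y := by
  simp [orbitRelZ, odometer_zpow_apply]

lemma isClopen_preimage_proj (k : ℕ) (S : Set (ZMod (mSeq nseq k))) :
    IsClopen (proj k ⁻¹' S : Set (OdoSpace nseq)) :=
  (isClopen_discrete S).preimage (continuous_proj k)

lemma exists_proj_intCast (k : ℕ) (z : ZMod (mSeq nseq k)) :
    ∃ n : ℤ, proj k (n : OdoSpace nseq) = z := by
  obtain ⟨n, rfl⟩ := ZMod.intCast_surjective z
  exact ⟨n, map_intCast _ _⟩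

/-- The natural numbers all of whose prime factors occur with infinite multiplicity in the
supernatural number `∏ i, nseq i`. -/
def multipliers (nseq : ℕ → ℕ) : Submonoid ℕ where
  carrier := {a | ∀ k, ∃ l, a * mSeq nseq k ∣ mSeq nseq l}
  one_mem' k := ⟨k, by rw [one_mul]⟩
  mul_mem' {a b} ha hb k := by
    obtain ⟨l, hl⟩ := hb k
    obtain ⟨r, hr⟩ := ha l
    exact ⟨r, by rw [mul_assoc]; exact (mul_dvd_mul_left a hl).trans hr⟩

lemma natCast_mul_injective {a : ℕ} (ha : a ∈ multipliers nseq) (h0 : a ≠ 0) :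
    Function.Injective fun x : OdoSpace nseq => (a : OdoSpace nseq) * x := by
  refine (injective_iff_map_eq_zero (AddMonoidHom.mulLeft (a : OdoSpace nseq))).2 fun x hx => ?_
  ext k
  obtain ⟨l, hl⟩ := ha k
  obtain ⟨z, hz⟩ := ZMod.intCast_surjective (proj (max k l) x)
  have h1 : ((a * z : ℤ) : ZMod (mSeq nseq (max k l))) = 0 := by
    have := congrArg (proj (max k l)) hx
    simpa [hz] using this
  rw [ZMod.intCast_zmod_eq_zero_iff_dvd] at h1
  have h2 : ((a * mSeq nseq k : ℕ) : ℤ) ∣ a * z :=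
    (Int.natCast_dvd_natCast.2 (hl.trans (mSeq_dvd_of_le (le_max_right k l)))).trans h1
  rw [Nat.cast_mul] at h2
  have h3 := Int.dvd_of_mul_dvd_mul_left (by exact_mod_cast h0) h2
  rw [← castHom_proj (le_max_left k l), ← hz, map_intCast, map_zero,
    ZMod.intCast_zmod_eq_zero_iff_dvd]
  exact h3

lemma dvd_of_intCast_eq_natCast_mul {a : ℕ} (ha : a ∈ multipliers nseq) {n : ℤ}
    {x : OdoSpace nseq} (h : (n : OdoSpace nseq) = a * x) : (a : ℤ) ∣ n := by
  obtain ⟨l, hl⟩ := ha 0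
  have hal : a ∣ mSeq nseq l := (Dvd.intro _ rfl).trans hl
  have := congrArg ((ZMod.castHom hal (ZMod a)).comp (proj l)) h
  rwa [map_intCast, map_mul, map_natCast, ZMod.natCast_self, zero_mul,
    ZMod.intCast_zmod_eq_zero_iff_dvd] at this

lemma orbitRel_natCast_mul_iff {a : ℕ} (ha : a ∈ multipliers nseq) (h0 : a ≠ 0)
    {x y : OdoSpace nseq} {n : ℤ} : (a * x, a * y + n) ∈ orbitRelZ (odometer nseq) ↔
      (x, y) ∈ orbitRelZ (odometer nseq) := by
  simp only [mem_orbitRelZ]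
  constructor
  · rintro ⟨m, hm⟩
    obtain ⟨d, hd⟩ := dvd_of_intCast_eq_natCast_mul ha (n := m - n) (x := y - x)
      (by push_cast; linear_combination hm)
    refine ⟨d, natCast_mul_injective ha h0 ?_⟩
    have := congrArg (Int.cast : ℤ → OdoSpace nseq) hd
    push_cast at this
    linear_combination hm - this
  · rintro ⟨m, rfl⟩
    exact ⟨a * m + n, by push_cast; ring⟩

variable [hn : Fact (∀ i, 2 ≤ nseq i)]

instance : CompactSpace (OdoSpace nseq) := by
  have h : IsClosed {x : ∀ k, ZMod (mSeq nseq k) |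
      ∀ k, ZMod.castHom (mSeq_dvd nseq k) (ZMod (mSeq nseq k)) (x (k + 1)) = x k} := by
    simp only [Set.ofPred_forall]
    exact isClosed_iInter fun k => isClosed_eq
      (continuous_of_discreteTopology.comp (continuous_apply (k + 1))) (continuous_apply k)
  exact isCompact_iff_compactSpace.1 h.isCompact

lemma exists_fiber_subset {V : Set (OdoSpace nseq)} (hV : IsOpen V) {x : OdoSpace nseq}
    (hx : x ∈ V) : ∃ k, ∀ y, proj k y = proj k x → y ∈ V := by
  have hc : ∀ k, IsClosed {y : OdoSpace nseq | proj k y = proj k x} := fun k =>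
    isClosed_eq (continuous_proj k) continuous_const
  refine exists_subset_nhds_of_isCompact' (V := fun k => {y | proj k y = proj k x}) ?_
    (fun k => (hc k).isCompact) hc fun y hy => ?_
  · exact (antitone_nat_of_succ_le fun k y hy => proj_eq_of_le k.le_succ hy).directed_ge
  · obtain rfl : y = x := ext_proj fun k => Set.mem_iInter.1 hy k
    exact hV.mem_nhds hx

lemma exists_eq_preimage_proj {V : Set (OdoSpace nseq)} (hV : IsClopen V) :
    ∃ k, ∃ S : Set (ZMod (mSeq nseq k)), V = proj k ⁻¹' S := by
  suffices h : ∃ k, ∃ S : Set (ZMod (mSeq nseq k)), V ⊆ proj k ⁻¹' S ∧ proj k ⁻¹' S ⊆ V by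
    obtain ⟨k, S, h1, h2⟩ := h
    exact ⟨k, S, h1.antisymm h2⟩
  refine hV.isClosed.isCompact.induction_on
    (p := fun s => ∃ k, ∃ S : Set (ZMod (mSeq nseq k)), s ⊆ proj k ⁻¹' S ∧ proj k ⁻¹' S ⊆ V)
    ⟨0, ∅, by simp⟩ (fun s t hst ⟨k, S, h1, h2⟩ => ⟨k, S, hst.trans h1, h2⟩) ?_ ?_
  · rintro s t ⟨k, S, h1, h2⟩ ⟨l, T, h3, h4⟩
    refine ⟨max k l, ZMod.castHom (mSeq_dvd_of_le (le_max_left k l)) _ ⁻¹' S ∪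
      ZMod.castHom (mSeq_dvd_of_le (le_max_right k l)) _ ⁻¹' T, ?_, ?_⟩
    · refine Set.union_subset (fun x hx => Or.inl ?_) fun x hx => Or.inr ?_
      · rw [Set.mem_preimage, castHom_proj (le_max_left k l)]; exact h1 hx
      · rw [Set.mem_preimage, castHom_proj (le_max_right k l)]; exact h3 hx
    · rintro x (hx | hx)
      · rw [Set.mem_preimage, castHom_proj (le_max_left k l)] at hx; exact h2 hx
      · rw [Set.mem_preimage, castHom_proj (le_max_right k l)] at hx; exact h4 hx
  · intro x hx
    obtain ⟨k, hk⟩ := exists_fiber_subset hV.isOpen hx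
    exact ⟨_, mem_nhdsWithin_of_mem_nhds
      ((isClopen_preimage_proj k {proj k x}).isOpen.mem_nhds rfl), k, {proj k x}, subset_rfl, hk⟩

lemma lt_mSeq (k : ℕ) : k < mSeq nseq k := by
  have h : 2 ^ (k + 1) ≤ mSeq nseq k := by
    simpa [mSeq] using Finset.prod_le_prod' (s := Finset.range (k + 1)) fun i _ => hn.out i
  have := Nat.lt_two_pow_self (n := k + 1)
  omega

lemma intCast_injective : Function.Injective (Int.cast : ℤ → OdoSpace nseq) := by
  refine (injective_iff_map_eq_zero (Int.castRingHom (OdoSpace nseq))).2 fun n hzero => ?_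
  have h : ((n : ℤ) : ZMod (mSeq nseq n.natAbs)) = 0 := by
    rw [← map_intCast (proj (nseq := nseq) n.natAbs) n]
    exact (congrArg _ hzero).trans (map_zero _)
  have h2 := (ZMod.intCast_zmod_eq_zero_iff_dvd _ _).1 h
  exact Int.eq_zero_of_abs_lt_dvd h2 (by rw [Int.abs_eq_natAbs]; exact_mod_cast lt_mSeq _)

lemma isFreeZ_odometer : IsFreeZ (odometer nseq) := by
  intro n h0 x hx
  rw [odometer_zpow_apply, add_eq_left] at hx
  exact h0 (intCast_injective (by rw [hx, Int.cast_zero]))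

lemma isMinimalRel_odometer : IsMinimalRel (orbitRelZ (odometer nseq)) := by
  intro x
  refine dense_iff_inter_open.2 fun V hV ⟨y, hy⟩ => ?_
  obtain ⟨k, hk⟩ := exists_fiber_subset hV hy
  obtain ⟨n, hn⟩ := exists_proj_intCast k (proj k (y - x))
  exact ⟨x + n, hk _ (by rw [map_add, hn, map_sub, add_sub_cancel]), mem_orbitRelZ.2 ⟨n, rfl⟩⟩

lemma perfect_univ : Perfect (Set.univ : Set (OdoSpace nseq)) := by
  refine ⟨isClosed_univ, fun x _ => accPt_iff_nhds.2 fun V hV => ?_⟩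
  obtain ⟨W, hWV, hW, hx⟩ := mem_nhds_iff.1 hV
  obtain ⟨k, hk⟩ := exists_fiber_subset hW hx
  refine ⟨x + (mSeq nseq k : ℤ), ⟨hWV (hk _ (by simp)), trivial⟩, fun h => ?_⟩
  rw [add_eq_left] at h
  have := intCast_injective (h.trans Int.cast_zero.symm)
  exact NeZero.ne (mSeq nseq k) (by exact_mod_cast this)

lemma measure_fiber {ν : Measure (OdoSpace nseq)} [IsProbabilityMeasure ν]
    (hν : ∀ A, MeasurableSet A → ν ((fun x => x + 1) ⁻¹' A) = ν A) (k : ℕ)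
    (z : ZMod (mSeq nseq k)) : ν (proj k ⁻¹' {z}) = (mSeq nseq k : ℝ≥0∞)⁻¹ := by
  have hm : ∀ z, MeasurableSet (proj k ⁻¹' {z} : Set (OdoSpace nseq)) := fun z =>
    (isClopen_preimage_proj k {z}).isOpen.measurableSet
  have hsucc : ∀ z, ν (proj k ⁻¹' {z + 1}) = ν (proj k ⁻¹' {z}) := fun z => by
    rw [← hν _ (hm _)]
    congr 1
    ext x
    simp
  have hconst : ∀ z, ν (proj k ⁻¹' {z}) = ν (proj k ⁻¹' {0}) := fun z => by
    obtain ⟨n, rfl⟩ := ZMod.natCast_zmod_surjective z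
    induction n with
    | zero => simp
    | succ n ih => rw [Nat.cast_succ, hsucc, ih]
  have hsum := sum_measure_preimage_singleton (μ := ν) Finset.univ fun z _ => hm z
  rw [Finset.coe_univ, Set.preimage_univ, measure_univ, Finset.sum_congr rfl fun z _ => hconst z,
    Finset.sum_const, Finset.card_univ, ZMod.card, nsmul_eq_mul, mul_comm] at hsum
  rw [hconst]
  exact ENNReal.eq_inv_of_mul_eq_one_left hsum

lemma measure_preimage_proj {ν : Measure (OdoSpace nseq)} [IsProbabilityMeasure ν]
    (hν : ∀ A, MeasurableSet A → ν ((fun x => x + 1) ⁻¹' A) = ν A) (k : ℕ)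
    (S : Set (ZMod (mSeq nseq k))) :
    ν (proj k ⁻¹' S) = S.ncard * (mSeq nseq k : ℝ≥0∞)⁻¹ := by
  classical
  have hsum := sum_measure_preimage_singleton (μ := ν) (f := proj k) S.toFinset fun z _ =>
    (isClopen_preimage_proj k {z}).isOpen.measurableSet
  rw [Set.coe_toFinset, Finset.sum_congr rfl fun z _ => measure_fiber hν k z,
    Finset.sum_const, nsmul_eq_mul, ← Set.ncard_eq_toFinset_card'] at hsum
  exact hsum.symm

lemma measure_unique {ν ν' : Measure (OdoSpace nseq)} [IsProbabilityMeasure ν]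
    [IsProbabilityMeasure ν'] (hν : ∀ A, MeasurableSet A → ν ((fun x => x + 1) ⁻¹' A) = ν A)
    (hν' : ∀ A, MeasurableSet A → ν' ((fun x => x + 1) ⁻¹' A) = ν' A) : ν = ν' := by
  refine ext_of_generate_finite {s : Set (OdoSpace nseq) | IsClopen s}
    (BorelSpace.measurable_eq.trans
      (TopologicalSpace.IsTopologicalBasis.borel_eq_generateFrom isTopologicalBasis_isClopen))
    (fun s hs t ht _ => IsClopen.inter hs ht) (fun s hs => ?_) (by simp)
  obtain ⟨k, S, rfl⟩ := exists_eq_preimage_proj hs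
  rw [measure_preimage_proj hν, measure_preimage_proj hν']

/-- The Haar probability measure of the odometer space. -/
noncomputable def haar (nseq : ℕ → ℕ) [Fact (∀ i, 2 ≤ nseq i)] : Measure (OdoSpace nseq) :=
  Measure.addHaarMeasure ⊤

instance : (haar nseq).IsAddHaarMeasure :=
  inferInstanceAs (Measure.addHaarMeasure ⊤).IsAddHaarMeasure

instance : IsProbabilityMeasure (haar nseq) :=
  ⟨Measure.addHaarMeasure_self (K₀ := (⊤ : TopologicalSpace.PositiveCompacts (OdoSpace nseq)))⟩

lemma haar_preimage_add_one (A : Set (OdoSpace nseq)) :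
    haar nseq ((fun x => x + 1) ⁻¹' A) = haar nseq A :=
  measure_preimage_add_right _ _ _

lemma isInvariantMeasure_haar : IsInvariantMeasure (orbitRelZ (odometer nseq)) (haar nseq) := by
  intro h hh
  ext A hA
  rw [Measure.map_apply h.measurable hA]
  have := measure_image_eq_of_forall_add (haar nseq) (v := Int.cast)
    (e₁ := id) (e₂ := h) intCast_injective
    Topology.IsClosedEmbedding.id h.isClosedEmbedding
    (fun x => by
      obtain ⟨n, hn⟩ := mem_orbitRelZ.1 (hh x)
      exact ⟨n, by rw [← hn, add_comm]; rfl⟩) (h.measurable hA)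
  rw [Set.image_preimage_eq _ h.surjective] at this
  simpa using this

lemma eq_haar_of_isInvariantMeasure {ν : Measure (OdoSpace nseq)} [IsProbabilityMeasure ν]
    (hν : IsInvariantMeasure (orbitRelZ (odometer nseq)) ν) : ν = haar nseq := by
  refine measure_unique (fun A hA => ?_) fun A _ => haar_preimage_add_one A
  have := hν (odometer nseq) fun x => mem_orbitRelZ.2 ⟨1, by rw [Int.cast_one]; rfl⟩
  conv_rhs => rw [← this, Measure.map_apply (odometer nseq).measurable hA]
  rfl

lemma prime_mem_multipliers {p : ℕ} (hp : p.Prime) (h : ∀ m : ℕ, ∃ k, p ^ m ∣ mSeq nseq k) :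
    p ∈ multipliers nseq := by
  intro k
  obtain ⟨j, c, hc, hk⟩ := Nat.exists_eq_pow_mul_and_not_dvd (NeZero.ne (mSeq nseq k)) p hp.ne_one
  obtain ⟨l, hl⟩ := h (j + 1)
  refine ⟨max k l, ?_⟩
  rw [hk, ← mul_assoc, ← pow_succ']
  refine Nat.Coprime.mul_dvd_of_dvd_of_dvd (((hp.coprime_iff_not_dvd).2 hc).pow_left _)
    (hl.trans (mSeq_dvd_of_le (le_max_right k l))) ?_
  exact (Dvd.intro_left _ hk.symm).trans (mSeq_dvd_of_le (le_max_left k l))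

lemma ne_zero_of_mem_multipliers {a : ℕ} (ha : a ∈ multipliers nseq) : a ≠ 0 := by
  rintro rfl
  obtain ⟨l, hl⟩ := ha 0
  rw [zero_mul, zero_dvd_iff] at hl
  exact NeZero.ne _ hl

lemma natCast_mul_add_bijective {a : ℕ} (ha : a ∈ multipliers nseq) :
    Function.Bijective fun q : OdoSpace nseq × Fin a => (a : OdoSpace nseq) * q.1 + (q.2 : ℕ) := by
  have h0 := ne_zero_of_mem_multipliers ha
  constructor
  · rintro ⟨x, i⟩ ⟨y, j⟩
      (h : a * x + ((i : ℕ) : OdoSpace nseq) = a * y + ((j : ℕ) : OdoSpace nseq))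
    have hd := dvd_of_intCast_eq_natCast_mul ha (n := (i : ℕ) - (j : ℕ)) (x := y - x)
      (by push_cast; linear_combination h)
    obtain rfl : i = j := by
      have := Int.eq_zero_of_abs_lt_dvd hd (by rw [abs_lt]; omega)
      omega
    rw [natCast_mul_injective ha h0 (add_right_cancel h)]
  · have hcont : Continuous fun q : OdoSpace nseq × Fin a =>
        (a : OdoSpace nseq) * q.1 + ((q.2 : ℕ) : OdoSpace nseq) :=
      (continuous_const.mul continuous_fst).add
        ((continuous_of_discreteTopology (f := fun i : Fin a => ((i : ℕ) : OdoSpace nseq))).comp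
          continuous_snd)
    have hdense : Dense (Set.range (Int.cast : ℤ → OdoSpace nseq)) := by
      refine (isMinimalRel_odometer (0 : OdoSpace nseq)).mono ?_
      rintro y hy
      obtain ⟨n, rfl⟩ := mem_orbitRelZ.1 hy
      exact ⟨n, by rw [zero_add]⟩
    rw [← Set.range_eq_univ, ← Set.univ_subset_iff, ← hdense.closure_eq]
    refine closure_minimal ?_ (isCompact_range hcont).isClosed
    rintro _ ⟨n, rfl⟩
    have hpos : (0 : ℤ) < a := by omega
    have h1 := Int.emod_nonneg n hpos.ne'
    refine ⟨((n / a : ℤ), ⟨(n % a).toNat, by have := Int.emod_lt_of_pos n hpos; omega⟩), ?_⟩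
    have h2 : (((n % a).toNat : ℕ) : OdoSpace nseq) = ((n % a : ℤ) : OdoSpace nseq) := by
      rw [← Int.cast_natCast, Int.toNat_of_nonneg h1]
    change (a : OdoSpace nseq) * ((n / a : ℤ) : OdoSpace nseq) +
      (((n % a).toNat : ℕ) : OdoSpace nseq) = n
    rw [h2]
    exact_mod_cast congrArg (Int.cast : ℤ → OdoSpace nseq) (Int.mul_ediv_add_emod n a)

/-- The self-similarity `(x, i) ↦ a * x + i` of the odometer space. -/
noncomputable def mulAddHomeomorph {a : ℕ} (ha : a ∈ multipliers nseq) :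
    OdoSpace nseq × Fin a ≃ₜ OdoSpace nseq :=
  Continuous.homeoOfEquivCompactToT2 (f := Equiv.ofBijective _ (natCast_mul_add_bijective ha))
    ((continuous_const.mul continuous_fst).add
      ((continuous_of_discreteTopology (f := fun i : Fin a => ((i : ℕ) : OdoSpace nseq))).comp
        continuous_snd))

lemma mulAddHomeomorph_apply {a : ℕ} (ha : a ∈ multipliers nseq) (q : OdoSpace nseq × Fin a) :
    mulAddHomeomorph ha q = a * q.1 + (q.2 : ℕ) := rfl

lemma isClopen_range_natCast_mul {a : ℕ} (ha : a ∈ multipliers nseq) :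
    IsClopen (Set.range fun x : OdoSpace nseq => (a : OdoSpace nseq) * x) := by
  have : NeZero a := ⟨ne_zero_of_mem_multipliers ha⟩
  have h : (Set.range fun x : OdoSpace nseq => (a : OdoSpace nseq) * x) =
      mulAddHomeomorph ha '' (Prod.snd ⁻¹' {0}) := by
    ext y
    simp [mulAddHomeomorph_apply]
  have hc : IsClopen (Prod.snd ⁻¹' {0} : Set (OdoSpace nseq × Fin a)) :=
    (isClopen_discrete _).preimage continuous_snd
  rw [h]
  exact ⟨(Homeomorph.isClosed_image _).2 hc.isClosed, (Homeomorph.isOpen_image _).2 hc.isOpen⟩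

lemma haar_range_natCast_mul {a : ℕ} (ha : a ∈ multipliers nseq) :
    haar nseq (Set.range fun x : OdoSpace nseq => (a : OdoSpace nseq) * x) = (a : ℝ≥0∞)⁻¹ := by
  set A := Set.range fun x : OdoSpace nseq => (a : OdoSpace nseq) * x with hA
  have hAm : MeasurableSet A := (isClopen_range_natCast_mul ha).isOpen.measurableSet
  let B : Fin a → Set (OdoSpace nseq) := fun i => (fun y => y - ((i : ℕ) : OdoSpace nseq)) ⁻¹' A
  have hB : ∀ i y, y ∈ B i ↔ ∃ x, mulAddHomeomorph ha (x, i) = y := fun i y => by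
    simp only [B, hA, Set.mem_preimage, Set.mem_range, mulAddHomeomorph_apply, eq_sub_iff_add_eq]
  have hU : ⋃ i, B i = Set.univ := by
    refine Set.eq_univ_of_forall fun y => ?_
    obtain ⟨⟨x, i⟩, h⟩ := (mulAddHomeomorph ha).surjective y
    exact Set.mem_iUnion.2 ⟨i, (hB i y).2 ⟨x, h⟩⟩
  have hd : Pairwise (Function.onFun Disjoint B) := fun i j hij =>
    Set.disjoint_left.2 fun y hi hj => by
      obtain ⟨x, hx⟩ := (hB i y).1 hi
      obtain ⟨x', hx'⟩ := (hB j y).1 hj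
      exact hij (congrArg Prod.snd ((mulAddHomeomorph ha).injective (hx.trans hx'.symm)))
  have hBA : ∀ i, haar nseq (B i) = haar nseq A := fun i => by
    simp only [B, sub_eq_add_neg]
    exact measure_preimage_add_right _ _ _
  have h := measure_iUnion (μ := haar nseq) hd fun i =>
    hAm.preimage (continuous_id.sub continuous_const).measurable
  rw [hU, measure_univ, tsum_fintype, Finset.sum_congr rfl fun i _ => hBA i, Finset.sum_const,
    Finset.card_univ, Fintype.card_fin, nsmul_eq_mul, mul_comm] at h
  exact ENNReal.eq_inv_of_mul_eq_one_left h.symm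

lemma div_mem_fundGroup {a b : ℕ} (ha : a ∈ multipliers nseq) (hb : b ∈ multipliers nseq) :
    (a / b : ℝ) ∈ fundGroup (orbitRelZ (odometer nseq)) (haar nseq) := by
  have ha0 := ne_zero_of_mem_multipliers ha
  have hb0 := ne_zero_of_mem_multipliers hb
  have hC := isClopen_range_natCast_mul hb
  set C := Set.range fun x : OdoSpace nseq => (b : OdoSpace nseq) * x
  have hU : IsClopen (C ×ˢ (Set.univ : Set (Fin a))) := hC.prod isClopen_univ
  let g : OdoSpace nseq × Fin a → (C ×ˢ (Set.univ : Set (Fin a)) : Set _) :=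
    fun q => ⟨(b * q.1, q.2), ⟨q.1, rfl⟩, trivial⟩
  have hgc : Continuous g :=
    ((continuous_const.mul continuous_fst).prodMk continuous_snd).subtype_mk _
  have hgb : Function.Bijective g := by
    constructor
    · intro q r h
      have h1 := congrArg (fun s => s.1) h
      exact Prod.ext (natCast_mul_injective hb hb0 (congrArg Prod.fst h1)) (congrArg Prod.snd h1 :)
    · rintro ⟨⟨y, i⟩, hy⟩
      obtain ⟨x, hx⟩ := hy.1
      exact ⟨(x, i), Subtype.ext (Prod.ext hx rfl)⟩
  let G := Continuous.homeoOfEquivCompactToT2 (f := Equiv.ofBijective g hgb) hgc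
  refine ⟨a, C ×ˢ Set.univ, hU, ⟨(mulAddHomeomorph ha).symm.trans G, fun x y => ?_⟩, ?_⟩
  · obtain ⟨⟨x, i⟩, rfl⟩ := (mulAddHomeomorph ha).surjective x
    obtain ⟨⟨y, j⟩, rfl⟩ := (mulAddHomeomorph ha).surjective y
    simp only [Homeomorph.trans_apply, Homeomorph.symm_apply_apply]
    rw [mulAddHomeomorph_apply, mulAddHomeomorph_apply]
    change _ ↔ (b * x, b * y) ∈ orbitRelZ (odometer nseq)
    have h1 := orbitRel_natCast_mul_iff hb hb0 (x := x) (y := y) (n := 0)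
    rw [Int.cast_zero, add_zero] at h1
    rw [h1, ← orbitRel_natCast_mul_iff ha ha0 (x := x) (y := y) (n := (j : ℕ) - (i : ℕ)),
      mem_orbitRelZ, mem_orbitRelZ]
    refine exists_congr fun n => ?_
    push_cast
    constructor <;> intro h <;> linear_combination h
  · rw [Measure.prod_prod, haar_range_natCast_mul hb, Measure.count_univ]
    simp [div_eq_inv_mul]

lemma prod_count_apply {n : ℕ} {W : Set (OdoSpace nseq × Fin n)} (hW : MeasurableSet W) :
    ((haar nseq).prod Measure.count) W = ∑ i, haar nseq ((fun x => (x, i)) ⁻¹' W) := by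
  rw [Measure.prod_apply_symm hW, lintegral_count, tsum_fintype]

/-- The additive monoid of the values of the Haar measure and its amplifications on clopen
sets. -/
def clopenValues (nseq : ℕ → ℕ) [Fact (∀ i, 2 ≤ nseq i)] : AddSubmonoid ℝ where
  carrier := {r | ∃ c k : ℕ, r = c / mSeq nseq k}
  zero_mem' := ⟨0, 0, by simp⟩
  add_mem' := by
    rintro _ _ ⟨c, k, rfl⟩ ⟨d, l, rfl⟩
    obtain ⟨q, hq⟩ := mSeq_dvd_of_le (nseq := nseq) (le_max_left k l)
    obtain ⟨r, hr⟩ := mSeq_dvd_of_le (nseq := nseq) (le_max_right k l)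
    have h0 : ∀ j, (mSeq nseq j : ℝ) ≠ 0 := fun j => Nat.cast_ne_zero.2 (NeZero.ne _)
    refine ⟨c * q + d * r, max k l, ?_⟩
    have hq' : (mSeq nseq (max k l) : ℝ) = mSeq nseq k * q := by exact_mod_cast hq
    have hr' : (mSeq nseq (max k l) : ℝ) = mSeq nseq l * r := by exact_mod_cast hr
    rw [div_add_div _ _ (h0 _) (h0 _), div_eq_div_iff (mul_ne_zero (h0 _) (h0 _)) (h0 _)]
    push_cast
    linear_combination c * mSeq nseq l * hq' + d * mSeq nseq k * hr'

lemma one_mem_clopenValues : (1 : ℝ) ∈ clopenValues nseq :=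
  ⟨mSeq nseq 0, 0, (div_self (Nat.cast_ne_zero.2 (NeZero.ne _))).symm⟩

lemma haar_preimage_proj (k : ℕ) (S : Set (ZMod (mSeq nseq k))) :
    (haar nseq (proj k ⁻¹' S)).toReal = S.ncard / mSeq nseq k := by
  rw [measure_preimage_proj fun A _ => haar_preimage_add_one A]
  simp [div_eq_mul_inv]

lemma haar_mem_clopenValues {V : Set (OdoSpace nseq)} (hV : IsClopen V) :
    (haar nseq V).toReal ∈ clopenValues nseq := by
  obtain ⟨k, S, rfl⟩ := exists_eq_preimage_proj hV
  exact ⟨_, k, haar_preimage_proj k S⟩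

lemma prod_count_mem_clopenValues {n : ℕ} {W : Set (OdoSpace nseq × Fin n)} (hW : IsClopen W) :
    (((haar nseq).prod Measure.count) W).toReal ∈ clopenValues nseq := by
  rw [prod_count_apply hW.isOpen.measurableSet, ENNReal.toReal_sum fun i _ => measure_ne_top _ _]
  exact sum_mem fun i _ => haar_mem_clopenValues (hW.preimage (by fun_prop))

/-- An orbit equivalence onto a clopen subset of an amplification scales the Haar measure. -/
lemma prod_count_image_eq_mul {n : ℕ} {U : Set (OdoSpace nseq × Fin n)} (hU : IsClopen U)
    (F : OdoSpace nseq ≃ₜ U) (hF : ∀ x y, (x, y) ∈ orbitRelZ (odometer nseq) ↔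
      (F x, F y) ∈ restrictRel (finProdRel (orbitRelZ (odometer nseq)) n) U)
    (h0 : 0 < ((haar nseq).prod Measure.count) U)
    (htop : ((haar nseq).prod Measure.count) U ≠ ⊤)
    {A : Set (OdoSpace nseq)} (hA : MeasurableSet A) :
    ((haar nseq).prod Measure.count) ((fun x => (F x : OdoSpace nseq × Fin n)) '' A) =
      ((haar nseq).prod Measure.count) U * haar nseq A := by
  have : NeZero n := ⟨by rintro rfl; exact Fin.elim0 (F 0).1.2⟩
  set lam := (haar nseq).prod (Measure.count : Measure (Fin n)) with hlam
  have hcount : (Measure.count : Measure (Fin n)).IsAddLeftInvariant :=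
    ⟨fun d => by
      ext s hs
      rw [Measure.map_apply (measurable_of_finite _) hs,
        Measure.count_apply (measurable_of_finite _ hs), Measure.count_apply hs,
        Set.encard_preimage_of_bijective (AddGroup.addLeft_bijective d)]⟩
  have he : Topology.IsClosedEmbedding fun x => (F x : OdoSpace nseq × Fin n) :=
    hU.isClosed.isClosedEmbedding_subtypeVal.comp F.isClosedEmbedding
  set e := fun x => (F x : OdoSpace nseq × Fin n) with he_def
  have hrange : e '' Set.univ = U := by
    rw [Set.image_univ]
    change Set.range (Subtype.val ∘ F) = U
    rw [F.surjective.range_comp, Subtype.range_coe]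
  have hT : ∀ B, MeasurableSet B → lam (e '' ((fun x => x + 1) ⁻¹' B)) = lam (e '' B) := by
    intro B hB
    have h := measure_image_eq_of_forall_add lam
      (v := fun p : ℤ × Fin n => ((p.1 : OdoSpace nseq), p.2))
      (e₁ := e) (e₂ := e ∘ Homeomorph.addRight 1)
      (fun p q hpq => Prod.ext (intCast_injective (congrArg Prod.fst hpq))
        (congrArg Prod.snd hpq :)) he (he.comp (Homeomorph.addRight 1).isClosedEmbedding)
      (fun z => by
        obtain ⟨m, hm⟩ := mem_orbitRelZ.1 ((hF z (z + 1)).1 (mem_orbitRelZ.2 ⟨1, by simp⟩))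
        refine ⟨(m, (e (z + 1)).2 - (e z).2), Prod.ext ?_ (sub_add_cancel _ _)⟩
        exact (add_comm _ _).trans hm)
      (hB.preimage (continuous_id.add continuous_const).measurable (f := fun x => x + 1))
    rw [h, Set.image_comp]
    congr 2
    exact Set.image_preimage_eq B (Homeomorph.addRight (1 : OdoSpace nseq)).surjective
  set ν := (lam U)⁻¹ • lam.comap e with hν
  have hν_apply : ∀ B, MeasurableSet B → ν B = (lam U)⁻¹ * lam (e '' B) := fun B hB => by
    rw [hν, Measure.smul_apply, he.measurableEmbedding.comap_apply, smul_eq_mul]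
  have hprob : IsProbabilityMeasure ν :=
    ⟨by rw [hν_apply _ .univ, hrange, ENNReal.inv_mul_cancel h0.ne' htop]⟩
  have hνhaar : ν = haar nseq := measure_unique (fun B hB => by
    rw [hν_apply _ hB, hν_apply ((fun x => x + 1) ⁻¹' B)
      (hB.preimage (continuous_id.add continuous_const).measurable), hT B hB])
    fun B _ => haar_preimage_add_one B
  rw [← hνhaar, hν_apply _ hA, ← mul_assoc, ENNReal.mul_inv_cancel h0.ne' htop, one_mul]

lemma mul_mem_clopenValues_of_mem_fundGroup {t : ℝ}
    (ht : t ∈ fundGroup (orbitRelZ (odometer nseq)) (haar nseq)) :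
    0 < t ∧ (∀ r ∈ clopenValues nseq, t * r ∈ clopenValues nseq) ∧
      ∀ r ∈ clopenValues nseq, t⁻¹ * r ∈ clopenValues nseq := by
  obtain ⟨n, U, hU, ⟨F, hF⟩, rfl⟩ := ht
  set lam := (haar nseq).prod (Measure.count : Measure (Fin n)) with hlam
  have h0 : 0 < lam U := by
    rw [hlam, prod_count_apply hU.isOpen.measurableSet]
    refine lt_of_lt_of_le ?_ (Finset.single_le_sum
      (f := fun i => haar nseq ((fun x => (x, i)) ⁻¹' U)) (fun _ _ => zero_le)
      (Finset.mem_univ (F 0).1.2))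
    exact (hU.isOpen.preimage (by fun_prop)).measure_pos _ ⟨(F 0).1.1, (F 0).2⟩
  have htop : lam U ≠ ⊤ := by
    rw [hlam, prod_count_apply hU.isOpen.measurableSet]
    exact ENNReal.sum_ne_top.2 fun i _ => measure_ne_top _ _
  have hpos := ENNReal.toReal_pos h0.ne' htop
  have hclosed : Topology.IsClosedEmbedding fun x => (F x : OdoSpace nseq × Fin n) :=
    hU.isClosed.isClosedEmbedding_subtypeVal.comp F.isClosedEmbedding
  have hopen : Topology.IsOpenEmbedding fun x => (F x : OdoSpace nseq × Fin n) :=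
    hU.isOpen.isOpenEmbedding_subtypeVal.comp F.isOpenEmbedding
  have hscale : ∀ A, IsClopen A → (lam ((fun x => (F x : OdoSpace nseq × Fin n)) '' A)).toReal =
      (lam U).toReal * (haar nseq A).toReal := fun A hA => by
    rw [hlam, prod_count_image_eq_mul hU F hF h0 htop hA.isOpen.measurableSet, ENNReal.toReal_mul]
  refine ⟨hpos, ?_, ?_⟩
  · rintro _ ⟨c, k, rfl⟩
    have hA : IsClopen (proj k ⁻¹' {0} : Set (OdoSpace nseq)) := isClopen_preimage_proj k {0}
    have h := prod_count_mem_clopenValues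
      ⟨hclosed.isClosedMap _ hA.isClosed, hopen.isOpenMap _ hA.isOpen⟩
    rw [← hlam, hscale _ hA, haar_preimage_proj, Set.ncard_singleton, Nat.cast_one] at h
    convert nsmul_mem h c using 1
    rw [nsmul_eq_mul]
    ring
  · rintro _ ⟨c, k, rfl⟩
    obtain ⟨⟨x, i⟩, hx⟩ : U.Nonempty := ⟨_, (F 0).2⟩
    obtain ⟨j, hj⟩ := exists_fiber_subset (hU.isOpen.preimage
      (f := fun x => (x, i)) (by fun_prop)) hx
    set l := max j k
    have hW : IsClopen ((proj l ⁻¹' {proj l x} : Set (OdoSpace nseq)) ×ˢ {i}) :=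
      (isClopen_preimage_proj l _).prod (isClopen_discrete _)
    have hWU : (proj l ⁻¹' {proj l x} : Set (OdoSpace nseq)) ×ˢ {i} ⊆ U := by
      rintro ⟨y, _⟩ ⟨hy, rfl⟩
      exact hj y (proj_eq_of_le (le_max_left j k) hy)
    have h := hscale _ (hW.preimage hclosed.continuous)
    have hr : Set.range (fun x => (F x : OdoSpace nseq × Fin n)) = U := by
      change Set.range (Subtype.val ∘ F) = U
      rw [F.surjective.range_comp, Subtype.range_coe]
    rw [Set.image_preimage_eq_of_subset (hWU.trans hr.ge), hlam, Measure.prod_prod,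
      Measure.count_singleton, mul_one, haar_preimage_proj, Set.ncard_singleton, Nat.cast_one,
      ← hlam] at h
    obtain ⟨q, hq⟩ := mSeq_dvd_of_le (nseq := nseq) (le_max_right j k)
    have h1 := haar_mem_clopenValues (hW.preimage hclosed.continuous)
    rw [← inv_mul_cancel_left₀ hpos.ne' (ENNReal.toReal _), ← h] at h1
    convert nsmul_mem h1 (c * q) using 1
    have hk : (mSeq nseq k : ℝ) ≠ 0 := Nat.cast_ne_zero.2 (NeZero.ne _)
    have hl : (mSeq nseq l : ℝ) ≠ 0 := Nat.cast_ne_zero.2 (NeZero.ne _)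
    have hq' : (mSeq nseq l : ℝ) = mSeq nseq k * q := by exact_mod_cast hq
    rw [nsmul_eq_mul]
    push_cast
    field_simp
    linear_combination c * hq'

lemma exists_pow_dvd_mSeq {a b : ℕ} (hb : b ≠ 0)
    (hab : a.Coprime b) (h : ∀ r ∈ clopenValues nseq, (a / b : ℝ) * r ∈ clopenValues nseq)
    (j : ℕ) : ∃ k, b ^ j ∣ mSeq nseq k := by
  have hpow : (a / b : ℝ) ^ j ∈ clopenValues nseq := by
    induction j with
    | zero => simpa using one_mem_clopenValues
    | succ j ih => rw [pow_succ']; exact h _ ih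
  obtain ⟨c, k, hk⟩ := hpow
  have hm : (mSeq nseq k : ℝ) ≠ 0 := Nat.cast_ne_zero.2 (NeZero.ne _)
  rw [div_pow, div_eq_div_iff (pow_ne_zero _ (Nat.cast_ne_zero.2 hb)) hm] at hk
  refine ⟨k, ((hab.pow j j).symm).dvd_of_dvd_mul_left (Dvd.intro_left c ?_)⟩
  exact_mod_cast hk.symm

lemma fundGroup_eq : fundGroup (orbitRelZ (odometer nseq)) (haar nseq) =
    {x : ℝ | ∃ f : ℕ →₀ ℤ,
      (∀ p ∈ f.support, Nat.Prime p ∧ ∀ m : ℕ, ∃ k, p ^ m ∣ mSeq nseq k) ∧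
      x = f.prod fun p m => (p : ℝ) ^ m} := by
  ext t
  constructor
  · intro ht
    obtain ⟨hpos, h1, h2⟩ := mul_mem_clopenValues_of_mem_fundGroup ht
    obtain ⟨c, k, hck⟩ := h1 1 one_mem_clopenValues
    rw [mul_one] at hck
    obtain ⟨a, b, hab, hc, hm⟩ := Nat.exists_coprime c (mSeq nseq k)
    have hm0 : b * c.gcd (mSeq nseq k) ≠ 0 := hm ▸ NeZero.ne (mSeq nseq k)
    have hb0 := left_ne_zero_of_mul hm0
    have hg0 : (c.gcd (mSeq nseq k) : ℝ) ≠ 0 := Nat.cast_ne_zero.2 (right_ne_zero_of_mul hm0)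
    have htab : t = a / b := by
      have hc' : (c : ℝ) = a * c.gcd (mSeq nseq k) := by exact_mod_cast hc
      have hm' : (mSeq nseq k : ℝ) = b * c.gcd (mSeq nseq k) := by exact_mod_cast hm
      rw [hck, hc', hm', mul_div_mul_right _ _ hg0]
    have ha0 : a ≠ 0 := by
      rintro rfl
      simp [htab] at hpos
    have hb := exists_pow_dvd_mSeq hb0 hab (by rwa [← htab])
    have ha := exists_pow_dvd_mSeq ha0 hab.symm (by rwa [← inv_div, ← htab])
    have hprime : ∀ {d : ℕ}, (∀ j : ℕ, ∃ k, d ^ j ∣ mSeq nseq k) → ∀ p ∈ d.factorization.support,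
        p.Prime ∧ ∀ m : ℕ, ∃ k, p ^ m ∣ mSeq nseq k := fun hd p hp =>
      ⟨Nat.prime_of_mem_primeFactors hp, fun m => (hd m).imp fun k hk =>
        (pow_dvd_pow_of_dvd (Nat.dvd_of_mem_primeFactors hp) m).trans hk⟩
    have hprod : ∀ {d : ℕ}, d ≠ 0 → (d.factorization.prod fun p m => (p : ℝ) ^ m) = d :=
        fun hd => by
      conv_rhs => rw [← Nat.prod_factorization_pow_eq_self hd]
      simp [Finsupp.prod]
    set fa : ℕ →₀ ℤ := a.factorization.mapRange (fun m : ℕ => (m : ℤ)) rfl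
    set fb : ℕ →₀ ℤ := b.factorization.mapRange (fun m : ℕ => -(m : ℤ)) rfl
    have hsupp : ∀ p ∈ fa.support ∪ fb.support, p.Prime ∧ ∀ m : ℕ, ∃ k, p ^ m ∣ mSeq nseq k := by
      intro p hp
      rcases Finset.mem_union.1 hp with hp | hp
      · exact hprime ha p (Finsupp.support_mapRange hp)
      · exact hprime hb p (Finsupp.support_mapRange hp)
    refine ⟨fa + fb, fun p hp => hsupp p (Finsupp.support_add hp), ?_⟩
    rw [Finsupp.prod_add_index (fun p _ => zpow_zero _) fun p hp m n =>
      zpow_add₀ (Nat.cast_ne_zero.2 (hsupp p hp).1.ne_zero) m n,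
      Finsupp.prod_mapRange_index fun p => zpow_zero _,
      Finsupp.prod_mapRange_index fun p => zpow_zero _]
    simp only [zpow_neg, zpow_natCast]
    rw [hprod ha0, Finsupp.prod, Finset.prod_inv_distrib, ← Finsupp.prod, hprod hb0, htab,
      div_eq_mul_inv]
  · rintro ⟨f, hf, rfl⟩
    have hmem : ∀ g : ℕ → ℕ, ∏ p ∈ f.support, p ^ g p ∈ multipliers nseq := fun g =>
      prod_mem fun p hp => pow_mem (prime_mem_multipliers (hf p hp).1 (hf p hp).2) _
    convert div_mem_fundGroup (hmem fun p => (f p).toNat) (hmem fun p => (-f p).toNat) using 1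
    push_cast
    rw [Finsupp.prod, ← Finset.prod_div_distrib]
    refine Finset.prod_congr rfl fun p hp => ?_
    conv_lhs => rw [← Int.toNat_sub_toNat_neg (f p)]
    rw [zpow_sub₀ (Nat.cast_ne_zero.2 (hf p hp).1.ne_zero), zpow_natCast, zpow_natCast]

end OdoSpace

/-- The odometer associated with `(n_i)`, `n_i ≥ 2`, is a uniquely ergodic
Cantor minimal `ℤ`-system whose fundamental group is the multiplicative subgroup of `ℝ_{>0}`
generated by the primes `p` with `ε_p = ∞` (i.e. `p^m ∣ n_1⋯n_k` for some `k`, for all `m`). -/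
theorem statement13 (nseq : ℕ → ℕ) (hn : ∀ i, 2 ≤ nseq i) :
    IsFreeZ (odometer nseq) ∧
    CompactSpace (OdoSpace nseq) ∧ TopologicalSpace.MetrizableSpace (OdoSpace nseq) ∧
    TotallyDisconnectedSpace (OdoSpace nseq) ∧ Nonempty (OdoSpace nseq) ∧
    Perfect (Set.univ : Set (OdoSpace nseq)) ∧
    IsMinimalRel (orbitRelZ (odometer nseq)) ∧
    ∃ μ : Measure (OdoSpace nseq), IsProbabilityMeasure μ ∧
      IsInvariantMeasure (orbitRelZ (odometer nseq)) μ ∧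
      (∀ ν : Measure (OdoSpace nseq), IsProbabilityMeasure ν →
        IsInvariantMeasure (orbitRelZ (odometer nseq)) ν → ν = μ) ∧
      fundGroup (orbitRelZ (odometer nseq)) μ =
        {x : ℝ | ∃ f : ℕ →₀ ℤ,
          (∀ p ∈ f.support, Nat.Prime p ∧ ∀ m : ℕ, ∃ k, p ^ m ∣ mSeq nseq k) ∧
          x = f.prod fun p m => (p : ℝ) ^ m} := by
  have : Fact (∀ i, 2 ≤ nseq i) := ⟨hn⟩
  exact ⟨OdoSpace.isFreeZ_odometer, inferInstance, inferInstance, inferInstance, ⟨0⟩,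
    OdoSpace.perfect_univ, OdoSpace.isMinimalRel_odometer, OdoSpace.haar nseq, inferInstance,
    OdoSpace.isInvariantMeasure_haar, fun _ _ h => OdoSpace.eq_haar_of_isInvariantMeasure h,
    OdoSpace.fundGroup_eq⟩
end

section
/- Let θ be an irrational real number that is not a quadratic irrational (i.e., θ is not algebraic of degree 2 over ℚ), and let R_{ℤ,φ} be a uniquely ergodic Cantor minimal ℤ-system (arising from a free action of ℤ on a Cantor set X) whose unique invariant probability measure μ satisfies E_μ = ℤ + ℤθ, where E_μ is the additive subgroup of ℝ generated by {μ(V) : V clopen in X}. Then F(R_{ℤ,φ}) = {1}. (This applies to the Denjoy system with rotation number θ and Q(φ_θ) = {e^{2πinθ} : n ∈ ℤ}, for which E_μ = ℤ + ℤθ.) -/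
open MeasureTheory
open scoped ENNReal

/-- A real number `t` stabilizing `ℤ + ℤθ`, with `θ` irrational and not quadratic, and inverting
some element of it, is `1` as soon as it is positive. -/
theorem eq_one_of_mul_mem_closure_pair {θ t : ℝ} (hirr : Irrational θ)
    (hquad : ¬ ∃ a b c : ℤ, a ≠ 0 ∧ (a : ℝ) * θ ^ 2 + (b : ℝ) * θ + (c : ℝ) = 0)
    (ht : 0 < t) (hmul : ∀ x ∈ AddSubgroup.closure {1, θ}, t * x ∈ AddSubgroup.closure {1, θ})
    (hinv : ∃ e ∈ AddSubgroup.closure {1, θ}, t * e = 1) : t = 1 := by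
  have hlin : ∀ a b : ℤ, (a : ℝ) + b * θ = 0 → b = 0 := by
    intro a b h
    by_contra hb
    have hb' : (b : ℝ) ≠ 0 := Int.cast_ne_zero.mpr hb
    refine hirr ⟨-(a : ℚ) / b, ?_⟩
    push_cast
    field_simp
    linarith
  have h1 := hmul 1 (AddSubgroup.subset_closure (by simp))
  have h2 := hmul θ (AddSubgroup.subset_closure (by simp))
  obtain ⟨e, he, hte⟩ := hinv
  rw [AddSubgroup.mem_closure_pair] at h1 h2 he
  obtain ⟨a, b, h1⟩ := h1
  obtain ⟨c, d, h2⟩ := h2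
  obtain ⟨p, q, rfl⟩ := he
  simp only [zsmul_eq_mul, mul_one] at h1 h2 hte
  have hb : b = 0 := by
    by_contra hb
    refine hquad ⟨b, a - d, -c, hb, ?_⟩
    push_cast
    rw [← h1] at h2
    linarith
  subst hb
  have hta : t = a := by simpa using h1.symm
  rw [hta] at hte ht
  have hq : a * q = 0 := hlin (a * p - 1) (a * q) (by push_cast; linarith)
  have ha : 0 < a := by exact_mod_cast ht
  have hq0 : q = 0 := by
    rcases mul_eq_zero.mp hq with h | h
    · omega
    · exact h
  subst hq0
  have hap : a * p = 1 := by
    have : (a : ℝ) * p = 1 := by simpa using hte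
    exact_mod_cast this
  have := Int.eq_one_or_neg_one_of_mul_eq_one hap
  have ha1 : a = 1 := by omega
  rw [hta, ha1, Int.cast_one]

/-- Evaluation of the product with the counting measure as a sum over the slices. -/
theorem prod_count_apply {Y : Type*} [MeasurableSpace Y] (μ : Measure Y) [SFinite μ] {n : ℕ}
    {A : Set (Y × Fin n)} (hA : MeasurableSet A) :
    (μ.prod Measure.count) A = ∑ i, μ ((fun x => (x, i)) ⁻¹' A) := by
  rw [Measure.prod_apply_symm hA, lintegral_fintype]
  simp

section OrbitRelations

variable {X : Type*} [TopologicalSpace X]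

/-- A relation is orbit equivalent to the restriction of its one-fold product to everything. -/
theorem orbitEquiv_restrictRel_finProdRel_one (R : Set (X × X)) :
    OrbitEquiv R (restrictRel (finProdRel R 1) Set.univ) :=
  ⟨(Homeomorph.prodUnique X (Fin 1)).symm.trans (Homeomorph.Set.univ _).symm,
    fun _ _ => Iff.rfl⟩

/-- Finitely many translates of a nonempty open set cover a minimal compact system. -/
theorem IsMinimalRel.exists_finset_cover [CompactSpace X] {φ : X ≃ₜ X}
    (hmin : IsMinimalRel (orbitRelZ φ))
    {O : Set X} (hO : IsOpen O) (hne : O.Nonempty) :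
    ∃ t : Finset ℤ, Set.univ ⊆ ⋃ k ∈ t, (φ ^ k) ⁻¹' O := by
  refine isCompact_univ.elim_finite_subcover (fun k : ℤ => (φ ^ k) ⁻¹' O)
    (fun k => hO.preimage (φ ^ k).continuous) fun x _ => ?_
  obtain ⟨y, hy, k, hk⟩ := (hmin x).inter_open_nonempty O hO hne
  exact Set.mem_iUnion.mpr ⟨k, show (φ ^ k) x ∈ O from hk ▸ hy⟩

/-- The product with counting measure takes values on clopen sets in the clopen value group. -/
theorem prod_count_clopen_mem_clopenValueGroup [MeasurableSpace X] [BorelSpace X]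
    [SecondCountableTopology X] (μ : Measure X) [IsFiniteMeasure μ] {n : ℕ}
    {A : Set (X × Fin n)} (hA : IsClopen A) :
    ((μ.prod Measure.count) A).toReal ∈ clopenValueGroup μ := by
  rw [prod_count_apply μ hA.isOpen.measurableSet, ENNReal.toReal_sum fun i _ => measure_ne_top _ _]
  exact sum_mem fun i _ => AddSubgroup.subset_closure
    ⟨_, hA.preimage (by fun_prop), rfl⟩

variable [MeasurableSpace X] [BorelSpace X] {φ : X ≃ₜ X} {μ : Measure X}

/-- Powers of the generating homeomorphism preserve an invariant measure. -/
theorem IsInvariantMeasure.measurePreserving_zpow (hinv : IsInvariantMeasure (orbitRelZ φ) μ)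
    (k : ℤ) : MeasurePreserving (φ ^ k).toMeasurableEquiv μ μ :=
  ⟨(φ ^ k).toMeasurableEquiv.measurable, hinv _ fun _ => ⟨k, rfl⟩⟩

/-- Invariance transfers along embeddings of the orbit relation into its `n`-fold product. -/
theorem IsInvariantMeasure.comap_prod_count [SecondCountableTopology X] [T2Space X]
    [IsProbabilityMeasure μ]
    (hinv : IsInvariantMeasure (orbitRelZ φ) μ) {n : ℕ} {F : X → X × Fin n}
    (hF : Topology.IsEmbedding F) (hFm : MeasurableEmbedding F)
    (hFR : ∀ x y, (x, y) ∈ orbitRelZ φ → (F x, F y) ∈ finProdRel (orbitRelZ φ) n) :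
    IsInvariantMeasure (orbitRelZ φ) ((μ.prod Measure.count).comap F) := by
  intro h hh
  set m : Measure (X × Fin n) := μ.prod Measure.count
  let T : ℤ × Equiv.Perm (Fin n) → (X × Fin n ≃ᵐ X × Fin n) := fun p =>
    (φ ^ p.1).toMeasurableEquiv.prodCongr
      ⟨p.2, measurable_from_top, measurable_from_top⟩
  have hT : ∀ p, MeasurePreserving (T p) m m := by
    intro p
    refine (hinv.measurePreserving_zpow p.1).prod (⟨measurable_from_top, ?_⟩ :
      MeasurePreserving p.2 Measure.count Measure.count)
    ext s hs
    rw [Measure.map_apply measurable_from_top hs, Measure.count_apply hs,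
      Measure.count_apply (measurable_from_top hs), ← Equiv.image_symm_eq_preimage,
      p.2.symm.injective.encard_image]
  have hTc : ∀ p, Continuous (T p) := fun p =>
    ((φ ^ p.1).continuous.comp continuous_fst).prodMk
      (continuous_of_discreteTopology.comp continuous_snd)
  let S : ℤ × Equiv.Perm (Fin n) → Set X := fun p => {x | F x = T p (F (h.symm x))}
  have hS : ⋃ p, S p = Set.univ := by
    rw [Set.eq_univ_iff_forall]
    intro x
    have hx := hFR _ _ (hh (h.symm x))
    rw [h.apply_symm_apply] at hx
    obtain ⟨k, hk⟩ := hx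
    refine Set.mem_iUnion.mpr ⟨(k, Equiv.swap (F (h.symm x)).2 (F x).2), ?_⟩
    exact Prod.ext hk.symm (Equiv.swap_apply_left _ _).symm
  have hSm : ∀ p, MeasurableSet (S p) := fun p =>
    (isClosed_eq hF.continuous
      ((hTc p).comp (hF.continuous.comp h.symm.continuous))).measurableSet
  refine (Measure.ext_iff_of_iUnion_eq_univ hS).mpr fun p => ?_
  ext A hA
  rw [Measure.restrict_apply hA, Measure.restrict_apply hA]
  have hB := hA.inter (hSm p)
  rw [Measure.map_apply h.measurable hB, hFm.comap_apply, hFm.comap_apply]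
  have himg : F '' (A ∩ S p) = T p '' (F '' (h ⁻¹' (A ∩ S p))) := by
    ext y
    constructor
    · rintro ⟨x, hx, rfl⟩
      exact ⟨_, ⟨h.symm x, by simpa using hx, rfl⟩, hx.2.symm⟩
    · rintro ⟨_, ⟨x, hx, rfl⟩, rfl⟩
      refine ⟨h x, hx, ?_⟩
      have := hx.2
      simp only [S, Set.mem_ofPred_eq, h.symm_apply_apply] at this
      exact this
  rw [himg, MeasurableEquiv.image_eq_preimage_symm]
  exact (((hT p).symm).measure_preimage_equiv _).symm

/-- A subgroup containing the measures of all clopen subsets of a clopen set `O` contains the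
measures of all clopen sets covered by finitely many translates of `O`. -/
theorem IsInvariantMeasure.measure_mem_of_subset_biUnion [IsFiniteMeasure μ]
    (hinv : IsInvariantMeasure (orbitRelZ φ) μ) (H : AddSubgroup ℝ) {O : Set X}
    (hO : IsClopen O) (hH : ∀ W ⊆ O, IsClopen W → (μ W).toReal ∈ H) (t : Finset ℤ) :
    ∀ V : Set X, IsClopen V → V ⊆ ⋃ k ∈ t, (φ ^ k) ⁻¹' O → (μ V).toReal ∈ H := by
  induction t using Finset.induction_on with
  | empty =>
    intro V _ hV
    have : V = ∅ := by simpa using hV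
    simp [this, H.zero_mem]
  | insert k t _ ih =>
    intro V hV hVt
    have hk : IsClopen ((φ ^ k) ⁻¹' O) := hO.preimage (φ ^ k).continuous
    have hsplit := measureReal_inter_add_sdiff (μ := μ) (s := V) hk.isOpen.measurableSet
    rw [Measure.real, Measure.real, Measure.real] at hsplit
    rw [← hsplit]
    refine H.add_mem ?_ (ih _ (hV.diff hk) ?_)
    · have himg : (φ ^ k) '' (V ∩ (φ ^ k) ⁻¹' O) ⊆ O := by
        rintro _ ⟨x, hx, rfl⟩
        exact hx.2
      have hcl : IsClopen ((φ ^ k) '' (V ∩ (φ ^ k) ⁻¹' O)) := by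
        rw [(φ ^ k).image_eq_preimage_symm]
        exact (hV.inter hk).preimage (φ ^ k).symm.continuous
      have hm := (hinv.measurePreserving_zpow k).measure_preimage_equiv
        ((φ ^ k) '' (V ∩ (φ ^ k) ⁻¹' O))
      have hpre : (φ ^ k).toMeasurableEquiv ⁻¹' ((φ ^ k) '' (V ∩ (φ ^ k) ⁻¹' O)) =
          V ∩ (φ ^ k) ⁻¹' O := Set.preimage_image_eq _ (φ ^ k).injective
      rw [hpre] at hm
      rw [hm]
      exact hH _ himg hcl
    · intro x hx
      have := hVt hx.1
      simp only [Finset.mem_insert, Set.iUnion_iUnion_eq_or_left, Set.mem_union] at this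
      exact this.resolve_left hx.2

end OrbitRelations

/-- If `θ` is irrational and not a quadratic irrational, any uniquely ergodic
Cantor minimal `ℤ`-system whose unique invariant measure satisfies `E_μ = ℤ + ℤθ` has trivial
fundamental group. -/
theorem statement14 (θ : ℝ) (hirr : Irrational θ)
    (hquad : ¬ ∃ a b c : ℤ, a ≠ 0 ∧ (a : ℝ) * θ ^ 2 + (b : ℝ) * θ + (c : ℝ) = 0)
    {X : Type*} [TopologicalSpace X] [CompactSpace X]
    [TopologicalSpace.MetrizableSpace X] [TotallyDisconnectedSpace X] [Nonempty X]
    [MeasurableSpace X] [BorelSpace X]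
    (hperf : Perfect (Set.univ : Set X))
    (φ : X ≃ₜ X) (hfree : IsFreeZ φ) (hmin : IsMinimalRel (orbitRelZ φ))
    (μ : Measure X) [IsProbabilityMeasure μ] (hinv : IsInvariantMeasure (orbitRelZ φ) μ)
    (huniq : ∀ ν : Measure X, IsProbabilityMeasure ν → IsInvariantMeasure (orbitRelZ φ) ν → ν = μ)
    (hE : clopenValueGroup μ = AddSubgroup.closure {1, θ}) :
    fundGroup (orbitRelZ φ) μ = {1} := by
  classical
  have : SecondCountableTopology X := by
    let := TopologicalSpace.metrizableSpaceMetric X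
    infer_instance
  refine Set.eq_singleton_iff_unique_mem.mpr ⟨⟨1, Set.univ, isClopen_univ,
    orbitEquiv_restrictRel_finProdRel_one _, ?_⟩, ?_⟩
  · rw [prod_count_apply μ MeasurableSet.univ]
    simp
  rintro l ⟨n, U, hU, ⟨G, hG⟩, rfl⟩
  set m : Measure (X × Fin n) := μ.prod Measure.count with hm
  let F : X → X × Fin n := fun x => (G x : X × Fin n)
  have hFemb : Topology.IsEmbedding F := Topology.IsEmbedding.subtypeVal.comp G.isEmbedding
  have hFrange : Set.range F = U := by
    rw [show F = Subtype.val ∘ G from rfl, Set.range_comp, G.surjective.range_eq, Set.image_univ,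
      Subtype.range_val]
  have hFopen : Topology.IsOpenEmbedding F := ⟨hFemb, hFrange ▸ hU.isOpen⟩
  have hFclosed : Topology.IsClosedEmbedding F := ⟨hFemb, hFrange ▸ hU.isClosed⟩
  have hFm : MeasurableEmbedding F := hFclosed.measurableEmbedding
  have hFR : ∀ x y, (x, y) ∈ orbitRelZ φ → (F x, F y) ∈ finProdRel (orbitRelZ φ) n :=
    fun x y h => (hG x y).mp h
  have hνinv := hinv.comap_prod_count hFemb hFm hFR
  rw [← hm] at hνinv
  obtain ⟨x₀⟩ := ‹Nonempty X›
  obtain ⟨i, hi⟩ : ∃ i, i = (F x₀).2 := ⟨_, rfl⟩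
  let O : Set X := (fun x => (x, i)) ⁻¹' U
  have hOcl : IsClopen O := hU.preimage (by fun_prop)
  have hOne : O.Nonempty := ⟨(F x₀).1, by
    change ((F x₀).1, i) ∈ U
    rw [hi]
    exact (G x₀).2⟩
  obtain ⟨t, ht⟩ := hmin.exists_finset_cover hOcl.isOpen hOne
  have hUtop : m U ≠ ∞ := by
    rw [hm, prod_count_apply μ hU.isOpen.measurableSet]
    exact ENNReal.sum_ne_top.mpr fun i _ => measure_ne_top _ _
  have hUzero : m U ≠ 0 := by
    intro h0
    rw [hm, prod_count_apply μ hU.isOpen.measurableSet, Finset.sum_eq_zero_iff] at h0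
    have hO0 : μ O = 0 := h0 i (Finset.mem_univ i)
    have h1 := hinv.measure_mem_of_subset_biUnion ⊥ hOcl
      (fun W hW _ => by simp [measure_mono_null hW hO0]) t Set.univ isClopen_univ ht
    simp at h1
  have hνuniv : m.comap F Set.univ = m U := by
    rw [hFm.comap_apply, Set.image_univ, hFrange]
  have hνeq : m.comap F = m U • μ := by
    have hprob : IsProbabilityMeasure ((m U)⁻¹ • m.comap F) :=
      ⟨by simp [hνuniv, ENNReal.inv_mul_cancel hUzero hUtop]⟩
    rw [← huniq _ hprob fun h hh => by rw [Measure.map_smul, hνinv h hh], smul_smul,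
      ENNReal.mul_inv_cancel hUzero hUtop, one_smul]
  have hval : ∀ A : Set X, (m (F '' A)).toReal = (m U).toReal * (μ A).toReal := by
    intro A
    rw [← hFm.comap_apply, hνeq, Measure.smul_apply, smul_eq_mul, ENNReal.toReal_mul]
  refine eq_one_of_mul_mem_closure_pair hirr hquad (ENNReal.toReal_pos hUzero hUtop) ?_ ?_
  · rw [← hE]
    intro x hx
    have hle : clopenValueGroup μ ≤
        (clopenValueGroup μ).comap (AddMonoidHom.mulLeft (m U).toReal) := by
      refine (AddSubgroup.closure_le _).mpr ?_
      rintro _ ⟨V, hV, rfl⟩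
      change (m U).toReal * (μ V).toReal ∈ clopenValueGroup μ
      rw [← hval]
      exact prod_count_clopen_mem_clopenValueGroup μ
        ⟨hFclosed.isClosedMap _ hV.isClosed, hFopen.isOpenMap _ hV.isOpen⟩
    exact hle hx
  · rw [← hE]
    have h1 := hinv.measure_mem_of_subset_biUnion
      ((clopenValueGroup μ).map (AddMonoidHom.mulLeft (m U).toReal)) hOcl ?_ t Set.univ
      isClopen_univ ht
    · obtain ⟨e, he, h⟩ := h1
      exact ⟨e, he, by simpa using h⟩
    · intro W hWO hW
      have hWi : IsClopen (W ×ˢ ({i} : Set (Fin n))) := hW.prod (isClopen_discrete _)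
      refine ⟨(μ (F ⁻¹' (W ×ˢ {i}))).toReal, AddSubgroup.subset_closure
        ⟨_, hWi.preimage hFemb.continuous, rfl⟩, ?_⟩
      change (m U).toReal * _ = _
      have hsub : W ×ˢ {i} ⊆ U := by
        rintro ⟨x, j⟩ ⟨hx, rfl⟩
        exact hWO hx
      rw [← hval, Set.image_preimage_eq_of_subset (hFrange ▸ hsub), hm, Measure.prod_prod]
      simp
end
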